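/- Let A > 0 and let π be any probability measure on ℝ supported on at most K points. Then TV(φ * π, φ * Unif([−A,A])) ≥ (1/4)·exp(−2π²K²/A²). -/

import Mathlib

open MeasureTheory Real Set

/-- Standard Gaussian density. -/
noncomputable def stdGaussianPDF (x : ℝ) : ℝ := (Real.sqrt (2 * π))⁻¹ * Real.exp (-x ^ 2 / 2)

/-- Convolution of the standard Gaussian density with a measure. -/
noncomputable def gaussConv (μ : Measure ℝ) (x : ℝ) : ℝ := ∫ t, stdGaussianPDF (x - t) ∂μ

/-- Density of the convolution of a standard Gaussian with `Unif([-A,A])`. -/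
noncomputable def fUnif (A x : ℝ) : ℝ :=
  ∫ t in Set.Icc (-A) A, stdGaussianPDF (x - t) * (1 / (2 * A))

open scoped BoundedContinuousFunction

theorem norm_exp_continuousLinearMap_le {E : Type*} [NormedAddCommGroup E] [NormedSpace ℂ E]
    [CompleteSpace E] (T : E →L[ℂ] E) : ‖NormedSpace.exp T‖ ≤ Real.exp ‖T‖ := by
  have h := NormedSpace.exp_series_hasSum_exp' (𝕂 := ℂ) T
  have hr := NormedSpace.exp_series_hasSum_exp' (𝕂 := ℝ) ‖T‖
  rw [← Real.exp_eq_exp_ℝ] at hr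
  refine h.norm_le_of_bounded hr fun n => ?_
  rw [norm_smul, smul_eq_mul]
  gcongr
  · simp
  · rcases n with _ | n
    · simpa using! ContinuousLinearMap.norm_id_le
    · exact norm_pow_le' T n.succ_pos

theorem exp_continuousLinearMap_apply_of_eigen {E : Type*} [NormedAddCommGroup E]
    [NormedSpace ℂ E] [CompleteSpace E] (T : E →L[ℂ] E) (v : E) (c : ℂ) (hv : T v = c • v) :
    NormedSpace.exp T v = Complex.exp c • v := by
  have h := NormedSpace.exp_series_hasSum_exp' (𝕂 := ℂ) T
  have hc := NormedSpace.exp_series_hasSum_exp' (𝕂 := ℂ) c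
  rw [← Complex.exp_eq_exp_ℂ] at hc
  have hpow : ∀ n : ℕ, (T ^ n) v = c ^ n • v := by
    intro n
    induction n with
    | zero => simp
    | succ n ih => rw [pow_succ', mul_apply_eq_comp, ih, map_smul, hv, smul_smul, pow_succ]
  have h1 := (ContinuousLinearMap.apply ℂ E v).hasSum h
  have h2 := hc.smul_const v
  refine h1.unique ?_
  convert h2 using 2 with n
  simp [hpow, smul_smul]

/-- The bounded continuous function `x ↦ exp (i ω x)`. -/
noncomputable def character (ω : ℝ) : ℝ →ᵇ ℂ :=
  BoundedContinuousFunction.ofNormedAddCommGroup (fun x : ℝ => Complex.exp (Complex.I * (ω * x : ℝ)))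
    (by fun_prop) 1 (fun x => by rw [mul_comm, Complex.norm_exp_ofReal_mul_I])

theorem character_apply (ω x : ℝ) : character ω x = Complex.exp (Complex.I * (ω * x : ℝ)) := rfl

/-- Translation by `a` as an operator on bounded continuous functions. -/
noncomputable def translation (a : ℝ) : (ℝ →ᵇ ℂ) →L[ℂ] (ℝ →ᵇ ℂ) :=
  BoundedContinuousFunction.compContinuousCLM (β := ℂ) ℂ (ContinuousMap.mk (fun x : ℝ => x + a))

theorem translation_apply (a : ℝ) (f : ℝ →ᵇ ℂ) (x : ℝ) : translation a f x = f (x + a) := rfl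

theorem norm_translation_le (a : ℝ) : ‖translation a‖ ≤ 1 :=
  ContinuousLinearMap.opNorm_le_bound _ zero_le_one fun f => by
    rw [one_mul]; exact f.norm_compContinuous_le _

theorem translation_add_translation_neg_character (a ω : ℝ) :
    (translation a + translation (-a)) (character ω) =
      ((2 * Real.cos (ω * a) : ℝ) : ℂ) • character ω := by
  ext x
  simp only [add_apply, BoundedContinuousFunction.add_apply,
    translation_apply, character_apply, BoundedContinuousFunction.smul_apply, smul_eq_mul]
  rw [Complex.ofReal_mul 2, Complex.ofReal_cos, Complex.ofReal_ofNat, Complex.two_cos, add_mul,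
    ← Complex.exp_add, ← Complex.exp_add]
  congr 2 <;> · push_cast; ring

/-- Fourier series of `ξ ^ 2` on `[-1, 1]`. -/
theorem hasSum_sq_fourier {ξ : ℝ} (hξ : |ξ| ≤ 1) :
    HasSum (fun n : ℕ => 4 * (-1) ^ n / (π ^ 2 * n ^ 2) * Real.cos (ξ * (n * π)))
      (ξ ^ 2 - 1 / 3) := by
  have hx : (1 + ξ) / 2 ∈ Icc (0 : ℝ) 1 := by
    rw [abs_le] at hξ; constructor <;> linarith
  have h := (hasSum_one_div_nat_pow_mul_cos one_ne_zero hx).mul_left (4 / π ^ 2)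
  convert! h using 1
  · ext n
    have : Real.cos (2 * π * n * ((1 + ξ) / 2)) = (-1) ^ n * Real.cos (ξ * (n * π)) := by
      rw [← Real.cos_add_nat_mul_pi]; ring_nf
    rw [this, mul_one]
    ring
  · have : Polynomial.eval ((1 + ξ) / 2)
        (Polynomial.map (algebraMap ℚ ℝ) (Polynomial.bernoulli (2 * 1))) = (ξ ^ 2 - 1 / 3) / 4 := by
      norm_num [Polynomial.bernoulli, Finset.sum_range_succ, Polynomial.eval_map,
        Polynomial.eval₂_monomial, bernoulli, bernoulli'_two]
      ring
    rw [this]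
    have := Real.pi_ne_zero
    norm_num [Nat.factorial]
    field_simp

theorem hasSum_norm_fourier : HasSum (fun n : ℕ => 4 / (π ^ 2 * n ^ 2)) (2 / 3 : ℝ) := by
  have h := hasSum_zeta_two.mul_left (4 / π ^ 2)
  have := Real.pi_ne_zero
  convert! h using 1
  · ext n
    ring
  · field_simp; norm_num

/-- A contraction acting on `character ω`, for `|ω| ≤ Ω`, as multiplication by `(ω / Ω) ^ 2`:
this is Bernstein's inequality for the second derivative, with interpolation nodes. -/
theorem exists_contraction_eigen {Ω : ℝ} (hΩ : 0 < Ω) :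
    ∃ B : (ℝ →ᵇ ℂ) →L[ℂ] (ℝ →ᵇ ℂ), ‖B‖ ≤ 1 ∧
      ∀ ω : ℝ, |ω| ≤ Ω → B (character ω) = (((ω / Ω) ^ 2 : ℝ) : ℂ) • character ω := by
  let b : ℕ → ℝ := fun n => 2 * (-1) ^ n / (π ^ 2 * n ^ 2)
  let T : ℕ → (ℝ →ᵇ ℂ) →L[ℂ] (ℝ →ᵇ ℂ) := fun n =>
    (b n : ℂ) • (translation (n * π / Ω) + translation (-(n * π / Ω)))
  have hT : ∀ n, ‖T n‖ ≤ 4 / (π ^ 2 * n ^ 2) := by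
    intro n
    calc ‖T n‖ ≤ ‖(b n : ℂ)‖ * (1 + 1) := by
          rw [norm_smul]
          gcongr
          refine (norm_add_le _ _).trans ?_
          exact add_le_add (norm_translation_le _) (norm_translation_le _)
      _ = 4 / (π ^ 2 * n ^ 2) := by
          rw [Complex.norm_real, Real.norm_eq_abs]
          simp only [b, abs_div, abs_mul, abs_pow, abs_neg, abs_one, one_pow, Nat.abs_ofNat,
            Nat.abs_cast, abs_of_pos Real.pi_pos]
          ring
  have hsum : Summable T := Summable.of_norm_bounded hasSum_norm_fourier.summable hT
  have hTs := hsum.hasSum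
  refine ⟨((1 / 3 : ℝ) : ℂ) • ContinuousLinearMap.id ℂ _ + ∑' n, T n, ?_, fun ω hω => ?_⟩
  · have h1 := hTs.norm_le_of_bounded hasSum_norm_fourier hT
    have h2 : ‖((1 / 3 : ℝ) : ℂ) • ContinuousLinearMap.id ℂ (ℝ →ᵇ ℂ)‖ ≤ 1 / 3 := by
      rw [norm_smul, Complex.norm_real, Real.norm_of_nonneg (by norm_num)]
      exact mul_le_of_le_one_right (by norm_num) ContinuousLinearMap.norm_id_le
    linarith [norm_add_le (((1 / 3 : ℝ) : ℂ) • ContinuousLinearMap.id ℂ (ℝ →ᵇ ℂ)) (∑' n, T n)]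
  · have hξ : |ω / Ω| ≤ 1 := by
      rw [abs_div, abs_of_pos hΩ]; exact (div_le_one hΩ).2 hω
    have h1 := (ContinuousLinearMap.apply ℂ _ (character ω)).hasSum hTs
    have h2 := (Complex.hasSum_ofReal.2 (hasSum_sq_fourier hξ)).smul_const (character ω)
    have h3 : (∑' n, T n) (character ω) = (((ω / Ω) ^ 2 - 1 / 3 : ℝ) : ℂ) • character ω := by
      refine h1.unique ?_
      convert! h2 using 2 with n
      simp only [ ContinuousLinearMap.apply_apply, T, smul_apply,
        translation_add_translation_neg_character, smul_smul, b]
      rw [← Complex.ofReal_mul]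
      congr 2
      rw [show ω * (n * π / Ω) = ω / Ω * (n * π) by ring]
      ring
    rw [add_apply, h3, smul_apply,
      ContinuousLinearMap.id_apply, ← add_smul, ← Complex.ofReal_add]
    congr 2
    ring

/-- Gaussian deconvolution of a trigonometric polynomial with frequencies in `[-Ω, Ω]` increases
its supremum norm by at most `exp (Ω ^ 2 / 2)`. -/
theorem norm_deconvolution_le {ι : Type*} (J : Finset ι) (c : ι → ℂ) (ω : ι → ℝ) {Ω : ℝ}
    (hΩ : 0 < Ω) (hω : ∀ i ∈ J, |ω i| ≤ Ω) :
    ‖∑ i ∈ J, (c i * Complex.exp ((ω i) ^ 2 / 2)) • character (ω i)‖ ≤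
      Real.exp (Ω ^ 2 / 2) * ‖∑ i ∈ J, c i • character (ω i)‖ := by
  obtain ⟨B, hB, hBω⟩ := exists_contraction_eigen hΩ
  have hD : NormedSpace.exp (((Ω ^ 2 / 2 : ℝ) : ℂ) • B) (∑ i ∈ J, c i • character (ω i)) =
      ∑ i ∈ J, (c i * Complex.exp ((ω i) ^ 2 / 2)) • character (ω i) := by
    rw [map_sum]
    refine Finset.sum_congr rfl fun i hi => ?_
    rw [map_smul, exp_continuousLinearMap_apply_of_eigen _ _ ((ω i) ^ 2 / 2), smul_smul]
    rw [smul_apply, hBω _ (hω i hi), smul_smul, ← Complex.ofReal_mul]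
    congr 1
    rw [show Ω ^ 2 / 2 * (ω i / Ω) ^ 2 = ω i ^ 2 / 2 by field_simp]
    push_cast
    rfl
  rw [← hD]
  refine (ContinuousLinearMap.le_opNorm _ _).trans ?_
  gcongr
  refine (norm_exp_continuousLinearMap_le _).trans ?_
  gcongr
  rw [norm_smul, Complex.norm_real, Real.norm_of_nonneg (by positivity)]
  exact mul_le_of_le_one_right (by positivity) hB

theorem stdGaussianPDF_eq_gaussianPDFReal :
    stdGaussianPDF = ProbabilityTheory.gaussianPDFReal 0 1 := by
  ext x
  simp [stdGaussianPDF, ProbabilityTheory.gaussianPDFReal]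

theorem integral_exp_mul_stdGaussianPDF (ω t : ℝ) :
    ∫ x, Complex.exp (Complex.I * (ω * x : ℝ)) * (stdGaussianPDF (x - t) : ℂ) =
      Complex.exp (-ω ^ 2 / 2) * Complex.exp (Complex.I * (ω * t : ℝ)) := by
  have h := ProbabilityTheory.charFun_gaussianReal (μ := t) (v := 1) ω
  rw [charFun_apply_real,
    ProbabilityTheory.integral_gaussianReal_eq_integral_smul one_ne_zero] at h
  rw [← Complex.exp_add]
  convert h using 2
  · ext x
    rw [stdGaussianPDF_eq_gaussianPDFReal, ProbabilityTheory.gaussianPDFReal_sub, zero_add,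
      Complex.real_smul, mul_comm]
    congr 2
    push_cast
    ring
  · push_cast
    ring

theorem integrable_prod_stdGaussianPDF (ν : Measure ℝ) [IsProbabilityMeasure ν] :
    Integrable (fun p : ℝ × ℝ => stdGaussianPDF (p.1 - p.2)) (volume.prod ν) := by
  have hm : Measurable (fun p : ℝ × ℝ => stdGaussianPDF (p.1 - p.2)) := by
    unfold stdGaussianPDF; fun_prop
  have hi : Integrable stdGaussianPDF := by
    rw [stdGaussianPDF_eq_gaussianPDFReal]
    exact ProbabilityTheory.integrable_gaussianPDFReal 0 1
  rw [integrable_prod_iff' hm.aestronglyMeasurable]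
  refine ⟨Filter.Eventually.of_forall fun t => hi.comp_sub_right t, ?_⟩
  have : ∀ t : ℝ, ∫ x, ‖stdGaussianPDF (x - t)‖ = ∫ x, ‖stdGaussianPDF x‖ := fun t =>
    integral_sub_right_eq_self (fun x => ‖stdGaussianPDF x‖) t
  simp only [this]
  exact integrable_const _

theorem integrable_gaussConv (ν : Measure ℝ) [IsProbabilityMeasure ν] :
    Integrable (gaussConv ν) :=
  (integrable_prod_stdGaussianPDF ν).integral_prod_left

theorem integral_exp_mul_gaussConv (ν : Measure ℝ) [IsProbabilityMeasure ν] (ω : ℝ) :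
    ∫ x, Complex.exp (Complex.I * (ω * x : ℝ)) * (gaussConv ν x : ℂ) =
      Complex.exp (-ω ^ 2 / 2) * ∫ t, Complex.exp (Complex.I * (ω * t : ℝ)) ∂ν := by
  simp only [gaussConv, ← integral_complex_ofReal, ← integral_const_mul]
  rw [integral_integral_swap]
  · exact integral_congr_ae (Filter.Eventually.of_forall fun t =>
      integral_exp_mul_stdGaussianPDF ω t)
  · refine Integrable.bdd_mul (c := 1) (integrable_prod_stdGaussianPDF ν).ofReal
      (Continuous.aestronglyMeasurable (by fun_prop)) (Filter.Eventually.of_forall fun p => ?_)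
    rw [mul_comm, Complex.norm_exp_ofReal_mul_I]

/-- Testing against trigonometric polynomials: a polynomial with frequencies in `[-Ω, Ω]` separates
two measures by at most `exp (Ω ^ 2 / 2)` times the `L¹` distance of their Gaussian smoothings. -/
theorem norm_integral_sub_integral_le (μ ν : Measure ℝ) [IsProbabilityMeasure μ]
    [IsProbabilityMeasure ν] {ι : Type*} (J : Finset ι) (c : ι → ℂ) (ω : ι → ℝ) {Ω : ℝ}
    (hΩ : 0 < Ω) (hω : ∀ i ∈ J, |ω i| ≤ Ω) :
    ‖∫ t, (∑ i ∈ J, c i • character (ω i)) t ∂μ - ∫ t, (∑ i ∈ J, c i • character (ω i)) t ∂ν‖ ≤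
      Real.exp (Ω ^ 2 / 2) * ‖∑ i ∈ J, c i • character (ω i)‖ *
        ∫ x, |gaussConv μ x - gaussConv ν x| := by
  set ψ := ∑ i ∈ J, (c i * Complex.exp ((ω i) ^ 2 / 2)) • character (ω i) with hψ
  have key : ∀ (ρ : Measure ℝ) [IsProbabilityMeasure ρ],
      Integrable (fun x => ψ x * (gaussConv ρ x : ℂ)) ∧
      ∫ x, ψ x * (gaussConv ρ x : ℂ) = ∫ t, (∑ i ∈ J, c i • character (ω i)) t ∂ρ := by
    intro ρ _
    have h_int : ∀ i, Integrable (fun x => character (ω i) x * (gaussConv ρ x : ℂ)) := fun i =>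
      (integrable_gaussConv ρ).ofReal.bdd_mul (c := ‖character (ω i)‖)
        (character (ω i)).continuous.aestronglyMeasurable
        (Filter.Eventually.of_forall (character (ω i)).norm_coe_le_norm)
    have hexp : ∀ x, ψ x * (gaussConv ρ x : ℂ) = ∑ i ∈ J,
        c i * Complex.exp ((ω i) ^ 2 / 2) * (character (ω i) x * (gaussConv ρ x : ℂ)) := by
      intro x
      simp only [hψ, BoundedContinuousFunction.coe_sum, Finset.sum_apply,
        BoundedContinuousFunction.coe_smul, smul_eq_mul, Finset.sum_mul, mul_assoc]
    simp only [hexp]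
    refine ⟨integrable_finsetSum _ fun i _ => (h_int i).const_mul _, ?_⟩
    rw [integral_finsetSum _ fun i _ => (h_int i).const_mul _]
    simp only [BoundedContinuousFunction.coe_sum, Finset.sum_apply,
      BoundedContinuousFunction.coe_smul, smul_eq_mul]
    rw [integral_finsetSum _ fun i _ =>
      ((character (ω i)).integrable ρ).const_mul _]
    refine Finset.sum_congr rfl fun i _ => ?_
    rw [integral_const_mul, integral_const_mul]
    simp only [character_apply]
    rw [integral_exp_mul_gaussConv, ← mul_assoc, mul_assoc (c i), ← Complex.exp_add]
    rw [show (ω i : ℂ) ^ 2 / 2 + -(ω i : ℂ) ^ 2 / 2 = 0 by ring, Complex.exp_zero, mul_one]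
  rw [← (key μ).2, ← (key ν).2, ← integral_sub (key μ).1 (key ν).1, ← integral_const_mul]
  refine norm_integral_le_of_norm_le
    ((((integrable_gaussConv μ).sub (integrable_gaussConv ν)).abs).const_mul _)
    (Filter.Eventually.of_forall fun x => ?_)
  rw [← mul_sub, norm_mul, ← Complex.ofReal_sub, Complex.norm_real, Real.norm_eq_abs]
  gcongr
  exact (ψ.norm_coe_le_norm x).trans (norm_deconvolution_le J c ω hΩ hω)

/-- The uniform distribution on `[-A, A]`. -/
noncomputable def uniformMeasure (A : ℝ) : Measure ℝ :=
  ENNReal.ofReal (1 / (2 * A)) • volume.restrict (Icc (-A) A)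

theorem isProbabilityMeasure_uniformMeasure {A : ℝ} (hA : 0 < A) :
    IsProbabilityMeasure (uniformMeasure A) := by
  refine ⟨?_⟩
  rw [uniformMeasure, Measure.smul_apply, Measure.restrict_apply_univ, Real.volume_Icc, smul_eq_mul,
    ← ENNReal.ofReal_mul (by positivity), show 1 / (2 * A) * (A - -A) = 1 by field_simp; ring,
    ENNReal.ofReal_one]

theorem gaussConv_uniformMeasure {A : ℝ} (hA : 0 < A) : gaussConv (uniformMeasure A) = fUnif A := by
  ext x
  rw [gaussConv, fUnif, uniformMeasure, integral_smul_measure,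
    ENNReal.toReal_ofReal (by positivity), integral_mul_const, smul_eq_mul, mul_comm]

/-- The Fejér kernel of order `n`, normalised to have mean one over a period `2 * A`. -/
noncomputable def fejerKernel (A : ℝ) (n : ℕ) (t : ℝ) : ℝ :=
  (n : ℝ)⁻¹ * ‖∑ l ∈ Finset.range n, Complex.exp (Complex.I * (π / A * t : ℝ)) ^ l‖ ^ 2

theorem fejerKernel_nonneg (A : ℝ) (n : ℕ) (t : ℝ) : 0 ≤ fejerKernel A n t := by
  unfold fejerKernel; positivity

theorem continuous_fejerKernel (A : ℝ) (n : ℕ) : Continuous (fejerKernel A n) := by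
  unfold fejerKernel; fun_prop

theorem fejerKernel_periodic {A : ℝ} (hA : 0 < A) (n : ℕ) :
    Function.Periodic (fejerKernel A n) (2 * A) := by
  intro t
  unfold fejerKernel
  have : Complex.I * (π / A * (t + 2 * A) : ℝ) =
      Complex.I * (π / A * t : ℝ) + 2 * π * Complex.I := by
    rw [show π / A * (t + 2 * A) = π / A * t + 2 * π by field_simp]
    push_cast; ring
  rw [this, Complex.exp_periodic]

theorem fejerKernel_eq_sum (A : ℝ) (n : ℕ) (t : ℝ) :
    (fejerKernel A n t : ℂ) = ∑ p ∈ Finset.range n ×ˢ Finset.range n,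
      (n : ℂ)⁻¹ * Complex.exp (Complex.I * (((p.1 : ℝ) - p.2) * (π / A) * t : ℝ)) := by
  rw [fejerKernel, Complex.ofReal_mul, Complex.ofReal_pow, ← Complex.mul_conj', map_sum,
    Finset.sum_mul_sum, ← Finset.sum_product', Finset.mul_sum]
  push_cast
  refine Finset.sum_congr rfl fun p _ => ?_
  rw [map_pow, ← Complex.exp_conj, ← Complex.exp_nat_mul, ← Complex.exp_nat_mul, ← Complex.exp_add]
  simp only [map_mul, Complex.conj_I, map_div₀, Complex.conj_ofReal]
  congr 2
  ring

theorem integral_exp_period {A : ℝ} (hA : 0 < A) {j : ℝ} (k : ℤ) (hj : j = k) :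
    ∫ t in (-A)..A, Complex.exp (Complex.I * (j * (π / A) * t : ℝ)) =
      if k = 0 then ((2 * A : ℝ) : ℂ) else 0 := by
  subst hj
  split_ifs with hk
  · subst hk
    simp
    ring
  · have hc : Complex.I * (k * (π / A)) ≠ 0 := by
      have : (k : ℂ) ≠ 0 := by exact_mod_cast hk
      have hA' : (A : ℂ) ≠ 0 := by exact_mod_cast hA.ne'
      have hp : (π : ℂ) ≠ 0 := by exact_mod_cast Real.pi_ne_zero
      exact mul_ne_zero Complex.I_ne_zero (mul_ne_zero this (div_ne_zero hp hA'))
    have := integral_exp_mul_complex (a := -A) (b := A) hc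
    push_cast at this ⊢
    simp only [mul_assoc] at this ⊢
    rw [this, div_eq_zero_iff]
    left
    rw [sub_eq_zero, Complex.exp_eq_exp_iff_exists_int]
    have hA' : (A : ℂ) ≠ 0 := by exact_mod_cast hA.ne'
    refine ⟨k, ?_⟩
    field_simp
    ring

theorem integral_fejerKernel {A : ℝ} (hA : 0 < A) {n : ℕ} (hn : n ≠ 0) :
    ∫ t in (-A)..A, fejerKernel A n t = 2 * A := by
  apply Complex.ofReal_injective
  rw [← intervalIntegral.integral_ofReal]
  simp only [fejerKernel_eq_sum]
  rw [intervalIntegral.integral_finsetSum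
    fun i _ => Continuous.intervalIntegrable (by fun_prop) _ _]
  simp only [intervalIntegral.integral_const_mul]
  have : ∀ p : ℕ × ℕ, ∫ t in (-A)..A, Complex.exp
      (Complex.I * (((p.1 : ℝ) - p.2) * (π / A) * t : ℝ)) =
      if p.1 = p.2 then ((2 * A : ℝ) : ℂ) else 0 := by
    intro p
    rw [integral_exp_period hA ((p.1 : ℤ) - p.2) (by push_cast; rfl)]
    simp [sub_eq_zero]
  simp only [this]
  rw [Finset.sum_product]
  have hn' : (n : ℂ) ≠ 0 := by exact_mod_cast hn
  simp only [mul_ite, mul_zero, Finset.sum_ite_eq, Finset.mem_range]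
  rw [Finset.sum_congr rfl fun x hx => if_pos (Finset.mem_range.1 hx)]
  simp [hn']

theorem integral_sub_left_eq_of_periodic {A : ℝ} {f : ℝ → ℝ} (hf : Function.Periodic f (2 * A))
    (x : ℝ) : ∫ s in (-A)..A, f (x - s) = ∫ s in (-A)..A, f s := by
  rw [intervalIntegral.integral_comp_sub_left f x]
  have := hf.intervalIntegral_add_eq (x - A) (-A)
  rwa [show x - A + 2 * A = x - -A by ring, show -A + 2 * A = A by ring] at this

theorem fejerKernel_lower_bound {A : ℝ} (hA : 0 < A) {n : ℕ} (hn : n ≠ 0) {t : ℝ}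
    (ht : |t| ≤ A / n) :
    n * (1 - (n * π / (2 * A) * t) ^ 2 / 6) ^ 2 ≤ fejerKernel A n t := by
  have hn0 : (0 : ℝ) < n := by exact_mod_cast Nat.pos_of_ne_zero hn
  rcases eq_or_ne t 0 with rfl | ht0
  · simp [fejerKernel]
    field_simp
    exact le_rfl
  wlog htpos : 0 < t generalizing t
  · have := this (t := -t) (by rwa [abs_neg]) (neg_ne_zero.2 ht0)
      (by have := lt_of_le_of_ne (not_lt.1 htpos) ht0; linarith)
    convert this using 1
    · ring
    · unfold fejerKernel
      rw [← Complex.norm_conj, map_sum]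
      simp only [map_pow, ← Complex.exp_conj, map_mul, Complex.conj_I, Complex.conj_ofReal]
      simp
  have hpi := Real.pi_pos
  rw [abs_of_pos htpos] at ht
  set v := n * π / (2 * A) * t with hv
  have hvpos : 0 < v := by positivity
  have hv2 : v ≤ π / 2 := by
    calc v ≤ n * π / (2 * A) * (A / n) := by rw [hv]; gcongr
      _ = π / 2 := by field_simp
  have hu : π / A * t / 2 = v / n := by rw [hv]; field_simp
  have hsin : 0 < Real.sin (v / n) := by
    apply Real.sin_pos_of_pos_of_lt_pi (by positivity)
    have : v / n ≤ v := div_le_self hvpos.le (by exact_mod_cast Nat.one_le_iff_ne_zero.2 hn)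
    linarith
  have h1 : ‖∑ l ∈ Finset.range n, Complex.exp (Complex.I * (π / A * t : ℝ)) ^ l‖ *
      Real.sin (v / n) = |Real.sin v| := by
    have h := congrArg norm (geom_sum_mul (Complex.exp (Complex.I * (π / A * t : ℝ))) n)
    rw [norm_mul, ← Complex.exp_nat_mul, show (n : ℂ) * (Complex.I * (π / A * t : ℝ)) =
      Complex.I * (n * (π / A * t) : ℝ) by push_cast; ring, Complex.norm_exp_I_mul_ofReal_sub_one,
      Complex.norm_exp_I_mul_ofReal_sub_one, norm_mul, norm_mul, Real.norm_eq_abs (Real.sin _),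
      Real.norm_eq_abs (Real.sin _), hu, show n * (π / A * t) / 2 = v by rw [hv]; ring,
      abs_of_pos hsin, Real.norm_ofNat] at h
    linarith
  have h2 : v - v ^ 3 / 6 ≤ |Real.sin v| :=
    (Real.sin_gt_sub_cube hvpos).le.trans (le_abs_self _)
  have h3 : Real.sin (v / n) ≤ v / n := Real.sin_le (by positivity)
  set S := ‖∑ l ∈ Finset.range n, Complex.exp (Complex.I * (π / A * t : ℝ)) ^ l‖ with hS
  have hS0 : 0 ≤ S := norm_nonneg _
  have h4 : n * (1 - v ^ 2 / 6) ≤ S := by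
    have : v - v ^ 3 / 6 ≤ S * (v / n) := by
      rw [← h1] at h2
      exact h2.trans (by gcongr)
    have h5 : (v / n) * (n * (1 - v ^ 2 / 6)) ≤ (v / n) * S := by
      calc (v / n) * (n * (1 - v ^ 2 / 6)) = v - v ^ 3 / 6 := by field_simp
        _ ≤ _ := by linarith
    exact le_of_mul_le_mul_left h5 (by positivity)
  have h6 : 0 ≤ n * (1 - v ^ 2 / 6) := by
    have : v ^ 2 ≤ 4 := by nlinarith [Real.pi_lt_four]
    apply mul_nonneg hn0.le; linarith
  calc n * (1 - v ^ 2 / 6) ^ 2 = (n : ℝ)⁻¹ * (n * (1 - v ^ 2 / 6)) ^ 2 := by field_simp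
    _ ≤ (n : ℝ)⁻¹ * S ^ 2 := by gcongr

/-- The Fejér kernel of order `n` puts three quarters of its mass on the central arc of relative
length `1 / n`. -/
theorem integral_fejerKernel_lower_bound {A : ℝ} (hA : 0 < A) {n : ℕ} (hn : n ≠ 0) :
    3 / 4 * (2 * A) ≤ ∫ t in (-(A / n))..(A / n), fejerKernel A n t := by
  have hn0 : (0 : ℝ) < n := by exact_mod_cast Nat.pos_of_ne_zero hn
  have hr : 0 < A / n := by positivity
  have h := intervalIntegral.integral_mono_on (μ := volume) (by linarith : -(A / n) ≤ A / n)
    (f := fun t => n * (1 - (n * π / (2 * A) * t) ^ 2 / 6) ^ 2) (g := fejerKernel A n)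
    (Continuous.intervalIntegrable (by fun_prop) _ _)
    ((continuous_fejerKernel A n).intervalIntegrable _ _)
    (fun t ht => fejerKernel_lower_bound hA hn (abs_le.2 ht))
  refine le_trans ?_ h
  set b := n * π / (2 * A) with hb
  have h_int : ∫ t in (-(A / n))..(A / n), (n : ℝ) * (1 - (b * t) ^ 2 / 6) ^ 2 =
      n * (2 * (A / n) - b ^ 2 / 3 * (2 * (A / n) ^ 3 / 3) + b ^ 4 / 36 * (2 * (A / n) ^ 5 / 5)) := by
    have : ∀ t, (n : ℝ) * (1 - (b * t) ^ 2 / 6) ^ 2 =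
        n * (1 - b ^ 2 / 3 * t ^ 2 + b ^ 4 / 36 * t ^ 4) := by intro t; ring
    simp only [this]
    rw [intervalIntegral.integral_const_mul, intervalIntegral.integral_add,
      intervalIntegral.integral_sub, intervalIntegral.integral_const_mul,
      intervalIntegral.integral_const_mul, integral_pow, integral_pow,
      intervalIntegral.integral_const]
    · simp only [smul_eq_mul]
      push_cast
      ring
    all_goals exact Continuous.intervalIntegrable (by fun_prop) _ _
  rw [h_int]
  have : n * (2 * (A / n) - b ^ 2 / 3 * (2 * (A / n) ^ 3 / 3) + b ^ 4 / 36 * (2 * (A / n) ^ 5 / 5)) =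
      2 * A * (1 - π ^ 2 / 36 + π ^ 4 / 2880) := by
    rw [hb]; field_simp; ring
  rw [this, mul_comm (3 / 4)]
  have h4 : π ^ 2 ≤ 9.93 := by nlinarith [Real.pi_lt_d2, Real.pi_pos]
  gcongr
  nlinarith [sq_nonneg (π ^ 2 - 9.9)]

/-- The `2 * A`-periodic extension of the indicator function of `[-r, r]`, for `0 ≤ r ≤ A`. -/
noncomputable def arcIndicator (A r u : ℝ) : ℝ :=
  if Real.cos (π / A * r) ≤ Real.cos (π / A * u) then 1 else 0

theorem measurable_arcIndicator (A r : ℝ) : Measurable (arcIndicator A r) :=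
  Measurable.ite (measurableSet_le (by fun_prop) (by fun_prop)) measurable_const measurable_const

theorem arcIndicator_nonneg (A r u : ℝ) : 0 ≤ arcIndicator A r u := by
  unfold arcIndicator; split_ifs <;> norm_num

theorem arcIndicator_le_one (A r u : ℝ) : arcIndicator A r u ≤ 1 := by
  unfold arcIndicator; split_ifs <;> norm_num

theorem arcIndicator_periodic {A : ℝ} (hA : 0 < A) (r : ℝ) :
    Function.Periodic (arcIndicator A r) (2 * A) := by
  intro u
  unfold arcIndicator
  rw [show π / A * (u + 2 * A) = π / A * u + 2 * π by field_simp, Real.cos_add_two_pi]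

theorem arcIndicator_eq_indicator {A r u : ℝ} (hA : 0 < A) (hr : 0 ≤ r) (hrA : r ≤ A)
    (hu : |u| ≤ A) : arcIndicator A r u = (Icc (-r) r).indicator 1 u := by
  have hd : 0 < π / A := div_pos Real.pi_pos hA
  have hmem : ∀ y, 0 ≤ y → y ≤ A → π / A * y ∈ Icc 0 π := fun y h0 h1 =>
    ⟨by positivity, by calc π / A * y ≤ π / A * A := by gcongr
                         _ = π := by field_simp⟩
  have : Real.cos (π / A * r) ≤ Real.cos (π / A * u) ↔ u ∈ Icc (-r) r := by
    rw [← Real.cos_abs (π / A * u), abs_mul, abs_of_pos hd,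
      Real.strictAntiOn_cos.le_iff_ge (hmem r hr hrA) (hmem |u| (abs_nonneg u) hu),
      mul_le_mul_iff_right₀ hd, abs_le, mem_Icc]
  by_cases h : u ∈ Icc (-r) r
  · rw [arcIndicator, if_pos (this.2 h), indicator_of_mem h, Pi.one_apply]
  · rw [arcIndicator, if_neg (mt this.1 h), indicator_of_notMem h]

theorem integral_arcIndicator_mul {A r : ℝ} (hA : 0 < A) (hr : 0 ≤ r) (hrA : r ≤ A) (f : ℝ → ℝ) :
    ∫ u in (-A)..A, arcIndicator A r u * f u = ∫ u in (-r)..r, f u := by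
  rw [intervalIntegral.integral_of_le (by linarith), intervalIntegral.integral_of_le (by linarith),
    ← integral_Icc_eq_integral_Ioc, ← integral_Icc_eq_integral_Ioc,
    setIntegral_congr_fun (g := (Icc (-r) r).indicator f) measurableSet_Icc,
    setIntegral_indicator measurableSet_Icc, inter_eq_right.2 (Icc_subset_Icc (by linarith) hrA)]
  intro u hu
  simp only [arcIndicator_eq_indicator hA hr hrA (abs_le.2 hu)]
  by_cases h : u ∈ Icc (-r) r <;> simp [h]

/-- The Fejér mean of a weight `w` on the circle of length `2 * A`. -/
noncomputable def fejerMean (A : ℝ) (n : ℕ) (w : ℝ → ℝ) (y : ℝ) : ℝ :=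
  1 / (2 * A) * ∫ s in (-A)..A, w s * fejerKernel A n (y - s)

theorem intervalIntegrable_bdd_mul {w f : ℝ → ℝ} (hw : Measurable w) {C : ℝ}
    (hC : ∀ s, |w s| ≤ C) (hf : Continuous f) (a b : ℝ) :
    IntervalIntegrable (fun s => w s * f s) volume a b := by
  rw [intervalIntegrable_iff]
  exact (intervalIntegrable_iff.1 (hf.intervalIntegrable a b)).bdd_mul (c := C)
    hw.aestronglyMeasurable (Filter.Eventually.of_forall hC)

theorem abs_fejerMean_le {A : ℝ} (hA : 0 < A) {n : ℕ} (hn : n ≠ 0) {w : ℝ → ℝ} {C : ℝ}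
    (hC : ∀ s, |w s| ≤ C) (y : ℝ) : |fejerMean A n w y| ≤ C := by
  have hcont : Continuous fun s => fejerKernel A n (y - s) :=
    (continuous_fejerKernel A n).comp (by fun_prop)
  have h := intervalIntegral.norm_integral_le_of_norm_le (μ := volume) (a := -A) (b := A)
    (f := fun s => w s * fejerKernel A n (y - s)) (g := fun s => C * fejerKernel A n (y - s))
    (by linarith) (Filter.Eventually.of_forall fun s _ => by
      rw [norm_mul, Real.norm_eq_abs, Real.norm_of_nonneg (fejerKernel_nonneg _ _ _)]
      exact mul_le_mul_of_nonneg_right (hC s) (fejerKernel_nonneg _ _ _))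
    ((hcont.const_mul C).intervalIntegrable _ _)
  rw [intervalIntegral.integral_const_mul,
    integral_sub_left_eq_of_periodic (fejerKernel_periodic hA n), integral_fejerKernel hA hn,
    Real.norm_eq_abs] at h
  rw [fejerMean, abs_mul, abs_of_pos (by positivity)]
  calc _ ≤ 1 / (2 * A) * (C * (2 * A)) := by gcongr
    _ = C := by field_simp

/-- The Fejér mean is a trigonometric polynomial. -/
theorem exists_fejerMean_eq_sum (A : ℝ) (n : ℕ) {w : ℝ → ℝ} (hw : Measurable w)
    {C : ℝ} (hC : ∀ s, |w s| ≤ C) : ∃ c : ℕ × ℕ → ℂ, ∀ y,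
      (∑ p ∈ Finset.range n ×ˢ Finset.range n,
        c p • character (((p.1 : ℝ) - p.2) * (π / A))) y = (fejerMean A n w y : ℂ) := by
  refine ⟨fun p => (1 / (2 * A) : ℝ) * ∫ s in (-A)..A, (w s : ℂ) *
    ((n : ℂ)⁻¹ * Complex.exp (Complex.I * (((p.1 : ℝ) - p.2) * (π / A) * (-s) : ℝ))), fun y => ?_⟩
  simp only [BoundedContinuousFunction.coe_sum, Finset.sum_apply,
    BoundedContinuousFunction.coe_smul, smul_eq_mul, character_apply]
  rw [fejerMean, Complex.ofReal_mul, ← intervalIntegral.integral_ofReal]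
  simp only [Complex.ofReal_mul (w _), fejerKernel_eq_sum, Finset.mul_sum]
  rw [intervalIntegral.integral_finsetSum, Finset.mul_sum]
  · refine Finset.sum_congr rfl fun p _ => ?_
    rw [mul_assoc, ← intervalIntegral.integral_mul_const]
    congr 2
    ext s
    rw [mul_assoc, mul_assoc, ← Complex.exp_add]
    congr 3
    push_cast
    ring
  · intro p _
    rw [intervalIntegrable_iff]
    refine Integrable.bdd_mul (c := C) (intervalIntegrable_iff.1
      (Continuous.intervalIntegrable (by fun_prop) _ _))
      (Complex.measurable_ofReal.comp hw).aestronglyMeasurable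
      (Filter.Eventually.of_forall fun s => ?_)
    rw [Complex.norm_real]
    exact hC s

theorem integral_uniformMeasure {A : ℝ} (hA : 0 < A) (f : ℝ → ℝ) :
    ∫ t, f t ∂(uniformMeasure A) = 1 / (2 * A) * ∫ t in (-A)..A, f t := by
  rw [uniformMeasure, integral_smul_measure, ENNReal.toReal_ofReal (by positivity), smul_eq_mul,
    intervalIntegral.integral_of_le (by linarith), integral_Icc_eq_integral_Ioc]

theorem integral_fejerMean {A : ℝ} (hA : 0 < A) {n : ℕ} (hn : n ≠ 0) {w : ℝ → ℝ}
    (hw : Measurable w) {C : ℝ} (hC : ∀ s, |w s| ≤ C) :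
    ∫ y in (-A)..A, fejerMean A n w y = ∫ s in (-A)..A, w s := by
  have hle : -A ≤ A := by linarith
  simp only [fejerMean, intervalIntegral.integral_const_mul]
  simp only [intervalIntegral.integral_of_le hle]
  rw [integral_integral_swap]
  · have : ∀ s, ∫ y in Ioc (-A) A, w s * fejerKernel A n (y - s) = w s * (2 * A) := by
      intro s
      rw [integral_const_mul, ← intervalIntegral.integral_of_le hle]
      congr 1
      rw [intervalIntegral.integral_comp_sub_right, ← integral_fejerKernel hA hn]
      have := (fejerKernel_periodic hA n).intervalIntegral_add_eq (-A - s) (-A)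
      rwa [show -A - s + 2 * A = A - s by ring, show -A + 2 * A = A by ring] at this
    simp only [this]
    rw [integral_mul_const]
    field_simp
  · have hF : Continuous fun p : ℝ × ℝ => fejerKernel A n (p.1 - p.2) :=
      (continuous_fejerKernel A n).comp (by fun_prop)
    refine Integrable.bdd_mul (c := C) ?_
      (hw.comp measurable_snd).aestronglyMeasurable (Filter.Eventually.of_forall fun p => hC p.2)
    rw [Measure.prod_restrict, ← Measure.volume_eq_prod]
    exact (hF.continuousOn.integrableOn_compact (isCompact_Icc.prod isCompact_Icc)).mono_set
      (prod_mono Ioc_subset_Icc_self Ioc_subset_Icc_self)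

/-- A trigonometric polynomial bounded by `1 / 2` which is large on a prescribed finite set of
points and has nonpositive mean. -/
theorem exists_weight_fejerMean {A : ℝ} (hA : 0 < A) {K : ℕ} (hK : K ≠ 0) (S : Finset ℝ)
    (hcard : S.card ≤ K) : ∃ w : ℝ → ℝ, Measurable w ∧ (∀ s, |w s| ≤ 1 / 2) ∧
      (∀ x ∈ S, 1 / 4 ≤ fejerMean A (2 * K) w x) ∧ ∫ s in (-A)..A, w s ≤ 0 := by
  have hK0 : (1 : ℝ) ≤ K := by exact_mod_cast Nat.one_le_iff_ne_zero.2 hK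
  have hn : 2 * K ≠ 0 := by omega
  set r := A / (2 * K : ℕ) with hr
  have hr0 : 0 ≤ r := by positivity
  have hrA : r ≤ A := div_le_self hA.le (by exact_mod_cast Nat.one_le_iff_ne_zero.2 hn)
  let χ := arcIndicator A r
  let N : ℝ → ℝ := fun s => ∑ x ∈ S, χ (x - s)
  let v : ℝ → ℝ := fun s => min 1 (N s)
  have hχm : ∀ x, Measurable fun s => χ (x - s) := fun x =>
    (measurable_arcIndicator A r).comp (by fun_prop)
  have hNm : Measurable N := Finset.measurable_fun_sum S fun x _ => hχm x
  have hvm : Measurable v := measurable_const.min hNm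
  have hv0 : ∀ s, 0 ≤ v s := fun s =>
    le_min zero_le_one (Finset.sum_nonneg fun x _ => arcIndicator_nonneg _ _ _)
  have hv1 : ∀ s, v s ≤ 1 := fun s => min_le_left _ _
  have hvχ : ∀ x ∈ S, ∀ s, χ (x - s) ≤ v s := fun x hx s =>
    le_min (arcIndicator_le_one _ _ _)
      (Finset.single_le_sum (f := fun x => χ (x - s)) (fun x _ => arcIndicator_nonneg _ _ _) hx)
  have hvabs : ∀ s, |v s| ≤ 1 := fun s => by rw [abs_of_nonneg (hv0 s)]; exact hv1 s
  have hχabs : ∀ x s, |χ (x - s)| ≤ 1 := fun x s => by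
    rw [abs_of_nonneg (arcIndicator_nonneg _ _ _)]; exact arcIndicator_le_one _ _ _
  have h_int : ∀ {f : ℝ → ℝ}, Measurable f → (∀ s, |f s| ≤ 1) →
      IntervalIntegrable f volume (-A) A := fun {f} hf hb => by
    simpa using intervalIntegrable_bdd_mul hf hb (continuous_const (y := (1 : ℝ))) (-A) A
  refine ⟨fun s => v s - 1 / 2, hvm.sub_const _, fun s => ?_, fun x hx => ?_, ?_⟩
  · rw [abs_le]; constructor <;> linarith [hv0 s, hv1 s]
  · have hFc : Continuous fun s => fejerKernel A (2 * K) (x - s) :=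
      (continuous_fejerKernel A _).comp (by fun_prop)
    have h1 : 3 / 4 * (2 * A) ≤ ∫ s in (-A)..A, v s * fejerKernel A (2 * K) (x - s) := by
      calc 3 / 4 * (2 * A) ≤ ∫ t in (-r)..r, fejerKernel A (2 * K) t :=
            integral_fejerKernel_lower_bound hA hn
        _ = ∫ u in (-A)..A, χ u * fejerKernel A (2 * K) u :=
            (integral_arcIndicator_mul hA hr0 hrA _).symm
        _ = ∫ s in (-A)..A, χ (x - s) * fejerKernel A (2 * K) (x - s) :=
            (integral_sub_left_eq_of_periodic
              ((arcIndicator_periodic hA r).mul (fejerKernel_periodic hA _)) x).symm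
        _ ≤ _ := intervalIntegral.integral_mono_on (by linarith)
            (intervalIntegrable_bdd_mul (hχm x) (hχabs x) hFc _ _)
            (intervalIntegrable_bdd_mul hvm hvabs hFc _ _)
            fun s _ => mul_le_mul_of_nonneg_right (hvχ x hx s) (fejerKernel_nonneg _ _ _)
    simp only [fejerMean, sub_mul]
    rw [intervalIntegral.integral_sub (intervalIntegrable_bdd_mul hvm hvabs hFc _ _)
      ((hFc.const_mul _).intervalIntegrable _ _), intervalIntegral.integral_const_mul,
      integral_sub_left_eq_of_periodic (fejerKernel_periodic hA _), integral_fejerKernel hA hn]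
    calc 1 / 4 = 1 / (2 * A) * (3 / 4 * (2 * A) - 1 / 2 * (2 * A)) := by field_simp; norm_num
      _ ≤ _ := by gcongr
  · have h1 : ∫ s in (-A)..A, v s ≤ A := by
      calc ∫ s in (-A)..A, v s ≤ ∫ s in (-A)..A, ∑ x ∈ S, χ (x - s) :=
            intervalIntegral.integral_mono_on (by linarith) (h_int hvm hvabs)
              (by simpa only [Finset.sum_fn] using
                IntervalIntegrable.sum S fun x _ => h_int (hχm x) (hχabs x))
              fun s _ => min_le_right _ _
        _ = ∑ x ∈ S, 2 * r := by
            rw [intervalIntegral.integral_finsetSum fun x _ => h_int (hχm x) (hχabs x)]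
            refine Finset.sum_congr rfl fun x _ => ?_
            rw [integral_sub_left_eq_of_periodic (arcIndicator_periodic hA r)]
            have := integral_arcIndicator_mul hA hr0 hrA fun _ => 1
            simp only [mul_one, intervalIntegral.integral_const, smul_eq_mul] at this
            rw [this]; ring
        _ = S.card * (2 * r) := by rw [Finset.sum_const, nsmul_eq_mul]
        _ ≤ K * (2 * r) := by gcongr
        _ = A := by rw [hr]; push_cast; field_simp
    rw [intervalIntegral.integral_sub (h_int hvm hvabs) (by simp), intervalIntegral.integral_const]
    simp only [smul_eq_mul]
    linarith

theorem tv_lower_bound_finite_mixture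
    (A : ℝ) (hA : 0 < A) (K : ℕ)
    (μ : Measure ℝ) (hμ : IsProbabilityMeasure μ)
    (s : Finset ℝ) (hcard : s.card ≤ K) (hsupp : μ (↑s : Set ℝ)ᶜ = 0) :
    (1 / 4) * Real.exp (-2 * π ^ 2 * (K : ℝ) ^ 2 / A ^ 2) ≤
      (1 / 2) * ∫ x, |gaussConv μ x - fUnif A x| := by
  have hK : K ≠ 0 := by
    rintro rfl
    rw [Finset.card_eq_zero.1 (Nat.le_zero.1 hcard), Finset.coe_empty, compl_empty,
      measure_univ] at hsupp
    exact one_ne_zero hsupp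
  have hn : 2 * K ≠ 0 := by omega
  obtain ⟨w, hwm, hw, hws, hw0⟩ := exists_weight_fejerMean hA hK s hcard
  obtain ⟨c, hc⟩ := exists_fejerMean_eq_sum A (2 * K) hwm hw
  have hU := isProbabilityMeasure_uniformMeasure hA
  have hΩ : 0 < π / A * (2 * K : ℕ) :=
    mul_pos (div_pos Real.pi_pos hA) (by exact_mod_cast Nat.pos_of_ne_zero hn)
  have h := norm_integral_sub_integral_le μ (uniformMeasure A)
    (Finset.range (2 * K) ×ˢ Finset.range (2 * K)) c
    (fun p => ((p.1 : ℝ) - p.2) * (π / A)) hΩ (fun p hp => by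
      rw [Finset.mem_product, Finset.mem_range, Finset.mem_range] at hp
      have h1 : (p.1 : ℝ) ≤ (2 * K : ℕ) := by exact_mod_cast hp.1.le
      have h2 : (p.2 : ℝ) ≤ (2 * K : ℕ) := by exact_mod_cast hp.2.le
      rw [abs_mul, abs_of_pos (div_pos Real.pi_pos hA), mul_comm]
      have := div_pos Real.pi_pos hA
      gcongr
      rw [abs_le]
      constructor <;> linarith [(p.1.cast_nonneg : (0 : ℝ) ≤ p.1), (p.2.cast_nonneg : (0 : ℝ) ≤ p.2)])
  set g := ∑ p ∈ Finset.range (2 * K) ×ˢ Finset.range (2 * K),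
    c p • character (((p.1 : ℝ) - p.2) * (π / A)) with hg
  have hgnorm : ‖g‖ ≤ 1 / 2 := by
    refine (BoundedContinuousFunction.norm_le (by norm_num)).2 fun y => ?_
    rw [hc, Complex.norm_real]
    exact abs_fejerMean_le hA hn hw y
  have h_int : Integrable (fejerMean A (2 * K) w) μ := by
    have := (g.integrable μ).re
    simpa only [hc, RCLike.re_to_complex, Complex.ofReal_re] using this
  have hμint : 1 / 4 ≤ ∫ t, fejerMean A (2 * K) w t ∂μ := by
    calc (1 : ℝ) / 4 = ∫ _, 1 / 4 ∂μ := by simp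
      _ ≤ _ := integral_mono_ae (integrable_const _) h_int (by
          have hae : ∀ᵐ t ∂μ, t ∈ (↑s : Set ℝ) := hsupp
          filter_upwards [hae] with t ht using hws t ht)
  have hUint : ∫ t, fejerMean A (2 * K) w t ∂(uniformMeasure A) ≤ 0 := by
    rw [integral_uniformMeasure hA, integral_fejerMean hA hn hwm hw]
    exact mul_nonpos_of_nonneg_of_nonpos (by positivity) hw0
  simp only [hc, integral_complex_ofReal] at h
  rw [← Complex.ofReal_sub, Complex.norm_real, gaussConv_uniformMeasure hA] at h
  have h1 : 1 / 4 ≤ Real.exp ((π / A * (2 * K : ℕ)) ^ 2 / 2) * (1 / 2) *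
      ∫ x, |gaussConv μ x - fUnif A x| := by
    calc (1 : ℝ) / 4 ≤ _ := (by linarith : (1 : ℝ) / 4 ≤ _).trans (le_abs_self _)
      _ ≤ _ := h
      _ ≤ _ := by gcongr
  have hE : -2 * π ^ 2 * (K : ℝ) ^ 2 / A ^ 2 = -((π / A * (2 * K : ℕ)) ^ 2 / 2) := by
    push_cast; field_simp
  rw [hE]
  calc _ ≤ Real.exp ((π / A * (2 * K : ℕ)) ^ 2 / 2) * (1 / 2) *
      (∫ x, |gaussConv μ x - fUnif A x|) * Real.exp (-((π / A * (2 * K : ℕ)) ^ 2 / 2)) := by gcongr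
    _ = (1 / 2) * (∫ x, |gaussConv μ x - fUnif A x|) * (Real.exp ((π / A * (2 * K : ℕ)) ^ 2 / 2) *
      Real.exp (-((π / A * (2 * K : ℕ)) ^ 2 / 2))) := by ring
    _ = _ := by rw [← Real.exp_add, add_neg_cancel, Real.exp_zero, mul_one]
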